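/- Let ρ be the rank function of a matricube on the hypercuboid C(r), let a ∈ C(r), and let I_a = { i ∈ {1, …, d} : a + e_i ∈ C(r) }. Define ρ_a : 2^{I_a} → ℤ by ρ_a(X) = ρ(a + Σ_{i ∈ X} e_i) − ρ(a). Then ρ_a is the rank function of a matroid on the ground set I_a; that is, ρ_a satisfies: 0 ≤ ρ_a(X) ≤ |X| for all X ⊆ I_a, ρ_a(Y) ≤ ρ_a(X) whenever Y ⊆ X ⊆ I_a, and ρ_a(X) + ρ_a(Y) ≥ ρ_a(X ∪ Y) + ρ_a(X ∩ Y) for all X, Y ⊆ I_a. -/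

import Mathlib

namespace Matricube

variable {d : ℕ}

/-- Membership in the hypercuboid `C(r)` of width `r`. -/
def mem (r x : Fin d → ℕ) : Prop := ∀ i, x i ≤ r i

/-- The `i`-th standard unit vector `eᵢ`. -/
def e (d : ℕ) (i : Fin d) : Fin d → ℕ := fun j => if j = i then 1 else 0

/-- The point `t · eᵢ` of the hypercuboid. -/
def unit (d : ℕ) (i : Fin d) (t : ℕ) : Fin d → ℕ := fun j => if j = i then t else 0

/-- Submodularity of a function on the hypercuboid `C(r)`. -/
def Submodular (r : Fin d → ℕ) (f : (Fin d → ℕ) → ℤ) : Prop :=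
  ∀ x y : Fin d → ℕ, mem r x → mem r y → f (x ⊔ y) + f (x ⊓ y) ≤ f x + f y

/-- Axioms (R1)-(R2)-(R3) for the rank function of a matricube on `C(r)`. -/
def IsRankFunction (r : Fin d → ℕ) (ρ : (Fin d → ℕ) → ℤ) : Prop :=
  (ρ 0 = 0 ∧ ∀ i : Fin d, ∀ t : ℕ, 1 ≤ t → t ≤ r i →
      ρ (unit d i t) - ρ (unit d i (t - 1)) ≤ 1) ∧
  (∀ x y : Fin d → ℕ, mem r x → mem r y → x ≤ y → ρ x ≤ ρ y) ∧
  Submodular r ρ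

/-- Axiom (R1*): the matricube is simple. -/
def IsSimple (r : Fin d → ℕ) (ρ : (Fin d → ℕ) → ℤ) : Prop :=
  ∀ i : Fin d, 0 < r i ∧ ∀ t : ℕ, t ≤ r i → ρ (unit d i t) = (t : ℤ)

/-- A flat of the matricube given by the rank function `ρ` on `C(r)`. -/
def IsFlat (r : Fin d → ℕ) (ρ : (Fin d → ℕ) → ℤ) (a : Fin d → ℕ) : Prop :=
  mem r a ∧ ∀ i : Fin d, mem r (a + e d i) → ρ (a + e d i) = ρ a + 1

/-- The set of flats of the matricube given by `ρ`. -/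
def flats (r : Fin d → ℕ) (ρ : (Fin d → ℕ) → ℤ) : Set (Fin d → ℕ) :=
  {a | IsFlat r ρ a}

/-- `CoversIn S a b` : `b` covers `a` in the poset `S`. -/
def CoversIn (S : Set (Fin d → ℕ)) (a b : Fin d → ℕ) : Prop :=
  a ∈ S ∧ b ∈ S ∧ a < b ∧ ∀ z ∈ S, ¬(a < z ∧ z < b)

/-- The rank function of the dual matricube. -/
def dualRank (r : Fin d → ℕ) (ρ : (Fin d → ℕ) → ℤ) : (Fin d → ℕ) → ℤ :=
  fun x => (∑ i, (x i : ℤ)) + ρ (r - x) - ρ r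

/-- Join-closure of a set: joins of nonempty (finite) families of its elements. -/
def joinClosure (A : Set (Fin d → ℕ)) : Set (Fin d → ℕ) :=
  {x | ∃ S : Finset (Fin d → ℕ), S.Nonempty ∧ ↑S ⊆ A ∧ x = S.sup id}

/-- `a` is join-irreducible in `A` : `a` is not the join of any set of elements of `A \ {a}`. -/
def JoinIrredIn (A : Set (Fin d → ℕ)) (a : Fin d → ℕ) : Prop :=
  ∀ S : Finset (Fin d → ℕ), S.Nonempty → ↑S ⊆ A \ {a} → S.sup id ≠ a

/-- The set of circuits of the matricube given by `ρ` on `C(r)`: the nonzero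
join-irreducible elements of `CC = {r - a : a a flat of the dual matricube}`. -/
def circuits (r : Fin d → ℕ) (ρ : (Fin d → ℕ) → ℤ) : Set (Fin d → ℕ) :=
  {c | c ∈ (fun a => r - a) '' flats r (dualRank r ρ) ∧ c ≠ 0 ∧
    JoinIrredIn ((fun a => r - a) '' flats r (dualRank r ρ)) c}

/-- An independent of the matricube given by `ρ` on `C(r)`. -/
def IsIndep (r : Fin d → ℕ) (ρ : (Fin d → ℕ) → ℤ) (a : Fin d → ℕ) : Prop :=
  mem r a ∧ ∀ i : Fin d, 1 ≤ a i → ρ (a - e d i) = ρ a - 1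

/-- The set of independents of the matricube given by `ρ`. -/
def indeps (r : Fin d → ℕ) (ρ : (Fin d → ℕ) → ℤ) : Set (Fin d → ℕ) :=
  {a | IsIndep r ρ a}

/-- `b` is the removal of `i` in `a` (in `J`): `b ∈ J` differs from `a` only in the `i`-th
coordinate, `b i < a i`, and `b` has the largest `i`-th coordinate among such elements. -/
def IsRemovalAt (J : Set (Fin d → ℕ)) (a : Fin d → ℕ) (i : Fin d) (b : Fin d → ℕ) : Prop :=
  b ∈ J ∧ b i < a i ∧ (∀ j : Fin d, j ≠ i → b j = a j) ∧
  ∀ c ∈ J, c i < a i → (∀ j : Fin d, j ≠ i → c j = a j) → c i ≤ b i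

/-- `b` is a removal of `a` in `J`. -/
def IsRemoval (J : Set (Fin d → ℕ)) (a b : Fin d → ℕ) : Prop :=
  ∃ i : Fin d, IsRemovalAt J a i b

/-- Removals exist in `J`. -/
def RemovalsExist (J : Set (Fin d → ℕ)) : Prop :=
  ∀ a ∈ J, ∀ i : Fin d, 1 ≤ a i → ∃ b, IsRemovalAt J a i b

/-- `a` can be reduced to `0` by a sequence of `m` removals in `J`. -/
def ReducesTo (J : Set (Fin d → ℕ)) (a : Fin d → ℕ) (m : ℕ) : Prop :=
  ∃ c : ℕ → (Fin d → ℕ), c 0 = a ∧ c m = 0 ∧ ∀ k, k < m → IsRemoval J (c k) (c (k + 1))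

/-- `J` is orderable: removals exist and all sequences of removals reducing a given
element to `0` have the same length. -/
def Orderable (J : Set (Fin d → ℕ)) : Prop :=
  RemovalsExist J ∧
  ∀ a ∈ J, ∀ m₁ m₂ : ℕ, ReducesTo J a m₁ → ReducesTo J a m₂ → m₁ = m₂

/-- Axiom (I1) for independents. -/
def AxiomI1 (J : Set (Fin d → ℕ)) : Prop :=
  RemovalsExist J ∧
  ∀ p ∈ J, ∀ i j : Fin d, ∀ bi bj : Fin d → ℕ,
    IsRemovalAt J p i bi → IsRemovalAt J p j bj →
    bi ⊓ bj ∈ J ∧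
    {c ∈ J | bi ⊓ bj ≤ c ∧ c ≤ bi}.ncard = {c ∈ J | bi ⊓ bj ≤ c ∧ c ≤ bj}.ncard

/-- Axiom (I2) for independents, relative to a size function `sz`. -/
def AxiomI2 (J : Set (Fin d → ℕ)) (sz : (Fin d → ℕ) → ℕ) : Prop :=
  (∀ a ∈ J, ∀ b ∈ J, a < b → sz a < sz b) ∧
  ∀ a ∈ J, ∀ b ∈ J, sz a < sz b → 2 ≤ {k : Fin d | a k < b k}.ncard →
    ∃ c ∈ J, c ≤ a ⊔ b ∧ sz a < sz c ∧ ∃ i : Fin d, a i < b i ∧ c i < b i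

/-- `P` is a dot array on the hypercube `[r]^d`. -/
def IsDotArray (r : ℕ) (P : Set (Fin d → ℕ)) : Prop := ∀ x ∈ P, ∀ i, x i ≤ r

/-- `rank_j (P[a])`: the number of values `t` such that the upper principal subarray
`P[a]` contains a dot whose `j`-th coordinate equals `t`. -/
noncomputable def arrayRank (P : Set (Fin d → ℕ)) (a : Fin d → ℕ) (j : Fin d) : ℕ :=
  {t : ℕ | ∃ y ∈ P, a ≤ y ∧ y j = t}.ncard

/-- `x` is a redundant position in the dot array `P`: `x` is the meet of at least two dotted
positions `≠ x`, each having at least one coordinate in common with `x`. -/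
def Redundant (P : Set (Fin d → ℕ)) (x : Fin d → ℕ) : Prop :=
  ∃ S : Finset (Fin d → ℕ), 2 ≤ S.card ∧ ↑S ⊆ P \ {x} ∧
    (∀ y ∈ S, ∃ i, y i = x i) ∧ (∀ y ∈ S, x ≤ y) ∧ ∀ z : Fin d → ℕ, (∀ y ∈ S, z ≤ y) → z ≤ x

/-- A permutation array of width `r` and dimension `d`: a totally rankable dot array on
`[r]^d` of rank `r + 1` with no redundant dots. -/
def IsPermutationArray (r : ℕ) (P : Set (Fin d → ℕ)) : Prop :=
  IsDotArray r P ∧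
  (∀ a : Fin d → ℕ, (∀ i, a i ≤ r) → ∀ j j' : Fin d, arrayRank P a j = arrayRank P a j') ∧
  (∀ j : Fin d, arrayRank P 0 j = r + 1) ∧
  (∀ x ∈ P, ¬Redundant P x)

/-- An increasing path `c 0 = 0, …, c m = a` in `C(r)`, with step directions `ℓ`. -/
def IncPath (r : Fin d → ℕ) (c : ℕ → Fin d → ℕ) (ℓ : ℕ → Fin d) (m : ℕ)
    (a : Fin d → ℕ) : Prop :=
  c 0 = 0 ∧ c m = a ∧ ∀ j, j < m → c (j + 1) = c j + e d (ℓ j) ∧ mem r (c (j + 1))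

theorem sum_e_apply (X : Finset (Fin d)) (j : Fin d) :
    (∑ i ∈ X, e d i) j = if j ∈ X then 1 else 0 := by
  simp [Finset.sum_apply, e]

theorem mem_add_sum_e {r a : Fin d → ℕ} (ha : mem r a) {X : Finset (Fin d)}
    (hX : ∀ i ∈ X, a i < r i) : mem r (a + ∑ i ∈ X, e d i) := by
  intro j
  rw [Pi.add_apply, sum_e_apply]
  split_ifs with hj
  · exact hX j hj
  · exact ha j

/-- Adding a unit vector increases the rank by at most one. -/
theorem IsRankFunction.add_e_le {r : Fin d → ℕ} {ρ : (Fin d → ℕ) → ℤ}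
    (h : IsRankFunction r ρ) {b : Fin d → ℕ} (hb : mem r b) {i : Fin d} (hi : b i < r i) :
    ρ (b + e d i) ≤ ρ b + 1 := by
  have hu : mem r (unit d i (b i + 1)) := by
    intro j
    unfold unit
    split_ifs with hj
    · subst hj
      exact hi
    · exact Nat.zero_le _
  have hsub := h.2.2 b (unit d i (b i + 1)) hb hu
  have hstep := h.1.2 i (b i + 1) (Nat.le_add_left _ _) hi
  have hsup : b ⊔ unit d i (b i + 1) = b + e d i := by
    ext j
    by_cases hj : j = i
    · subst hj
      simp [unit, e]
    · simp [unit, e, hj]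
  have hinf : b ⊓ unit d i (b i + 1) = unit d i (b i) := by
    ext j
    by_cases hj : j = i
    · subst hj
      simp [unit]
    · simp [unit, hj]
  rw [hsup, hinf] at hsub
  rw [Nat.add_sub_cancel] at hstep
  linarith

theorem IsRankFunction.add_sum_e_le {r : Fin d → ℕ} {ρ : (Fin d → ℕ) → ℤ}
    (h : IsRankFunction r ρ) {a : Fin d → ℕ} (ha : mem r a) (X : Finset (Fin d))
    (hX : ∀ i ∈ X, a i < r i) : ρ (a + ∑ i ∈ X, e d i) ≤ ρ a + X.card := by
  induction X using Finset.induction_on with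
  | empty => simp
  | insert i X hi ih =>
    have hX' : ∀ j ∈ X, a j < r j := fun j hj => hX j (Finset.mem_insert_of_mem hj)
    have hlt : (a + ∑ j ∈ X, e d j) i < r i := by
      rw [Pi.add_apply, sum_e_apply, if_neg hi]
      exact hX i (Finset.mem_insert_self i X)
    have hstep := h.add_e_le (mem_add_sum_e ha hX') hlt
    have hle := ih hX'
    rw [Finset.sum_insert hi, Finset.card_insert_of_notMem hi, add_comm (e d i), ← add_assoc]
    push_cast
    linarith

theorem add_sum_e_mono (a : Fin d → ℕ) {X Y : Finset (Fin d)} (hYX : Y ⊆ X) :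
    a + ∑ i ∈ Y, e d i ≤ a + ∑ i ∈ X, e d i := by
  gcongr

theorem add_sum_e_sup (a : Fin d → ℕ) (X Y : Finset (Fin d)) :
    (a + ∑ i ∈ X, e d i) ⊔ (a + ∑ i ∈ Y, e d i) = a + ∑ i ∈ X ∪ Y, e d i := by
  ext j
  simp only [Pi.sup_apply, Pi.add_apply, sum_e_apply, Finset.mem_union]
  by_cases hX : j ∈ X <;> by_cases hY : j ∈ Y <;> simp [hX, hY]

theorem add_sum_e_inf (a : Fin d → ℕ) (X Y : Finset (Fin d)) :
    (a + ∑ i ∈ X, e d i) ⊓ (a + ∑ i ∈ Y, e d i) = a + ∑ i ∈ X ∩ Y, e d i := by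
  ext j
  simp only [Pi.inf_apply, Pi.add_apply, sum_e_apply, Finset.mem_inter]
  by_cases hX : j ∈ X <;> by_cases hY : j ∈ Y <;> simp [hX, hY]

/-- The local function `ρ_a(X) = ρ(a + Σ_{i ∈ X} eᵢ) − ρ(a)` on subsets of
`I_a = { i : a + eᵢ ∈ C(r) }` is the rank function of a matroid. -/
theorem local_matroid (d : ℕ) (r : Fin d → ℕ) (ρ : (Fin d → ℕ) → ℤ)
    (h : IsRankFunction r ρ) (a : Fin d → ℕ) (ha : mem r a) :
    (∀ X : Finset (Fin d), (∀ i ∈ X, a i < r i) →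
      0 ≤ ρ (a + ∑ i ∈ X, e d i) - ρ a ∧
      ρ (a + ∑ i ∈ X, e d i) - ρ a ≤ X.card) ∧
    (∀ X Y : Finset (Fin d), Y ⊆ X → (∀ i ∈ X, a i < r i) →
      ρ (a + ∑ i ∈ Y, e d i) - ρ a ≤ ρ (a + ∑ i ∈ X, e d i) - ρ a) ∧
    (∀ X Y : Finset (Fin d), (∀ i ∈ X, a i < r i) → (∀ i ∈ Y, a i < r i) →
      (ρ (a + ∑ i ∈ X ∪ Y, e d i) - ρ a) + (ρ (a + ∑ i ∈ X ∩ Y, e d i) - ρ a) ≤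
        (ρ (a + ∑ i ∈ X, e d i) - ρ a) + (ρ (a + ∑ i ∈ Y, e d i) - ρ a)) := by
  refine ⟨fun X hX => ⟨?_, ?_⟩, fun X Y hYX hX => ?_, fun X Y hX hY => ?_⟩
  · exact sub_nonneg.mpr (h.2.1 _ _ ha (mem_add_sum_e ha hX) le_self_add)
  · have := h.add_sum_e_le ha X hX
    linarith
  · exact sub_le_sub_right (h.2.1 _ _ (mem_add_sum_e ha fun i hi => hX i (hYX hi))
      (mem_add_sum_e ha hX) (add_sum_e_mono a hYX)) _
  · have := h.2.2 _ _ (mem_add_sum_e ha hX) (mem_add_sum_e ha hY)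
    rw [add_sum_e_sup, add_sum_e_inf] at this
    linarith

end Matricube
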